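/- Let k be a positive integer and let ℓ be an odd integer with 3 ≤ ℓ ≤ 21. Then for every field F, M(F, Circ[(ℓ²−1)k, {1,ℓ}]) = Z(Circ[(ℓ²−1)k, {1,ℓ}]) = 2ℓ; moreover the adjacency matrix of Circ[(ℓ²−1)k, {1,ℓ}], with entries interpreted in F, has rank (ℓ²−1)k − 2ℓ over every field F, so the graph has field independent minimum rank and its adjacency matrix is a universally optimal matrix. -/

import Mathlib

open scoped Classical

noncomputable section

namespace Paper

variable {V : Type*}

/-- The set of vertices eventually colored blue starting from `Z` under the
zero forcing color change rule. -/
inductive Forced (G : SimpleGraph V) (Z : Set V) : V → Prop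
  | init (v : V) : v ∈ Z → Forced G Z v
  | force (u w : V) : Forced G Z u → G.Adj u w →
      (∀ x, G.Adj u x → x ≠ w → Forced G Z x) → Forced G Z w

/-- `Z` is a zero forcing set of `G`. -/
def IsZeroForcingSet (G : SimpleGraph V) (Z : Set V) : Prop := ∀ v, Forced G Z v

/-- The zero forcing number `Z(G)`. -/
def zfn (G : SimpleGraph V) : ℕ :=
  sInf {m | ∃ Z : Set V, Z.ncard = m ∧ IsZeroForcingSet G Z}

/-- Membership in the set `S(F,G)` of symmetric matrices described by `G`. -/
def SMat (F : Type*) [Field F] (G : SimpleGraph V) (A : Matrix V V F) : Prop :=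
  A.IsSymm ∧ ∀ i j : V, i ≠ j → (A i j ≠ 0 ↔ G.Adj i j)

/-- Maximum nullity `M(F,G)`. -/
def maxNullity (F : Type*) [Field F] [Fintype V] (G : SimpleGraph V) : ℕ :=
  sSup {m | ∃ A : Matrix V V F, SMat F G A ∧ Fintype.card V - A.rank = m}

/-- Minimum rank `mr(F,G)`. -/
def minRank (F : Type*) [Field F] [Fintype V] (G : SimpleGraph V) : ℕ :=
  sInf {m | ∃ A : Matrix V V F, SMat F G A ∧ A.rank = m}

/-- The Strong Arnold Property. -/
def HasSAP [Fintype V] [DecidableEq V] (A : Matrix V V ℝ) : Prop :=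
  ∀ X : Matrix V V ℝ, X.IsSymm → A * X = 0 → Matrix.hadamard A X = 0 →
    Matrix.hadamard (1 : Matrix V V ℝ) X = 0 → X = 0

/-- The Colin de Verdière type parameter `ξ(G)`. -/
def xi [Fintype V] [DecidableEq V] (G : SimpleGraph V) : ℕ :=
  sSup {m | ∃ A : Matrix V V ℝ, SMat ℝ G A ∧ HasSAP A ∧ Fintype.card V - A.rank = m}

/-- The adjacency matrix of `G` with entries in `R`. -/
def adjMat (R : Type*) [Zero R] [One R] (G : SimpleGraph V) : Matrix V V R :=
  Matrix.of fun i j => if G.Adj i j then 1 else 0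

/-- Minimum degree `δ(G)`. -/
def minDeg (G : SimpleGraph V) : ℕ :=
  sInf {d | ∃ v : V, (G.neighborSet v).ncard = d}

/-- Vertex connectivity `κ(G)`. -/
def vertexConnectivity [Fintype V] (G : SimpleGraph V) : ℕ :=
  if G = (⊤ : SimpleGraph V) then Fintype.card V - 1
  else sInf {m | ∃ S : Set V, S.ncard = m ∧ ¬ (G.induce Sᶜ).Connected}

/-- The circulant graph `Circ[n,S]`. -/
def circG (n : ℕ) (S : Set ℕ) : SimpleGraph (ZMod n) :=
  SimpleGraph.fromRel (fun i j => ∃ s ∈ S, j = i + (s : ZMod n))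

section ZeroForcing

variable {F : Type*} [Field F]

/-- A kernel vector vanishing on `Z` vanishes on every vertex forced by `Z`. -/
theorem Forced.apply_eq_zero [Fintype V] {G : SimpleGraph V} {Z : Set V} {A : Matrix V V F}
    (hA : SMat F G A) {v : V → F} (hv : A.mulVec v = 0) (hZ : ∀ z ∈ Z, v z = 0)
    {w : V} (hw : Forced G Z w) : v w = 0 := by
  induction hw with
  | init w hw => exact hZ w hw
  | force u w _ huw _ hu hx =>
    have hsum : ∑ x, A u x * v x = 0 := congrFun hv u
    rw [Finset.sum_eq_single w] at hsum
    · exact (mul_eq_zero.mp hsum).resolve_left ((hA.2 u w huw.ne).mpr huw)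
    · intro x _ hxw
      by_cases hux : u = x
      · rw [← hux, hu, mul_zero]
      · by_cases hadj : G.Adj u x
        · rw [hx x hadj hxw, mul_zero]
        · rw [not_not.mp (mt (hA.2 u x hux).mp hadj), zero_mul]
    · exact fun h => absurd (Finset.mem_univ w) h

theorem card_sub_rank_le_ncard [Fintype V] {G : SimpleGraph V} {Z : Set V}
    (hZ : IsZeroForcingSet G Z) {A : Matrix V V F} (hA : SMat F G A) :
    Fintype.card V - A.rank ≤ Z.ncard := by
  have hker := A.mulVecLin.finrank_range_add_finrank_ker
  rw [Module.finrank_pi] at hker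
  let restr : LinearMap.ker A.mulVecLin →ₗ[F] (Z → F) :=
    (LinearMap.funLeft F F (Subtype.val : Z → V)).comp (Submodule.subtype _)
  have hinj : Function.Injective restr := by
    rw [← LinearMap.ker_eq_bot, LinearMap.ker_eq_bot']
    rintro ⟨v, hv⟩ h
    ext w
    exact (hZ w).apply_eq_zero hA (by simpa using hv) fun z hz => congrFun h ⟨z, hz⟩
  have hle := LinearMap.finrank_le_finrank_of_injective hinj
  rw [Module.finrank_pi, ← Nat.card_eq_fintype_card, Nat.card_coe_set_eq] at hle
  rw [Matrix.rank]
  omega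

theorem sMat_adjMat (G : SimpleGraph V) : SMat F G (adjMat F G) := by
  refine ⟨?_, fun i j _ => ?_⟩
  · ext i j
    simp [adjMat, G.adj_comm]
  · simp [adjMat]

/-- If the nullity of the adjacency matrix attains the size of some zero forcing set, then all
the zero forcing and rank parameters are determined by that number. -/
theorem parameters_eq_of_adjMat_rank_le [Fintype V] {G : SimpleGraph V} {Z : Set V}
    (hZ : IsZeroForcingSet G Z) (hcard : Z.ncard ≤ Fintype.card V)
    (hrank : (adjMat F G).rank ≤ Fintype.card V - Z.ncard) :
    maxNullity F G = Z.ncard ∧ zfn G = Z.ncard ∧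
      (adjMat F G).rank = Fintype.card V - Z.ncard ∧ minRank F G = (adjMat F G).rank := by
  have hlow := card_sub_rank_le_ncard hZ (sMat_adjMat (F := F) G)
  have hrank_eq : (adjMat F G).rank = Fintype.card V - Z.ncard := by omega
  refine ⟨?_, ?_, hrank_eq, ?_⟩
  · refine IsGreatest.csSup_eq ⟨⟨_, sMat_adjMat G, by omega⟩, ?_⟩
    rintro _ ⟨A, hA, rfl⟩
    exact card_sub_rank_le_ncard hZ hA
  · refine IsLeast.csInf_eq ⟨⟨Z, rfl, hZ⟩, ?_⟩
    rintro _ ⟨Y, rfl, hY⟩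
    have := card_sub_rank_le_ncard hY (sMat_adjMat (F := F) G)
    omega
  · refine IsLeast.csInf_eq ⟨⟨_, sMat_adjMat G, rfl⟩, ?_⟩
    rintro _ ⟨A, hA, rfl⟩
    have := card_sub_rank_le_ncard hZ hA
    omega

end ZeroForcing

section Circulant

variable {n l : ℕ}

theorem natCast_zmod_ne_zero {m : ℕ} (hm : 0 < m) (hmn : m < n) : (m : ZMod n) ≠ 0 := fun h =>
  absurd (Nat.le_of_dvd hm ((ZMod.natCast_eq_zero_iff m n).mp h)) (by omega)

theorem circG_adj_iff (hl : 1 < l) (hn : 2 * l < n) (i j : ZMod n) :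
    (circG n {1, l}).Adj i j ↔ j = i + 1 ∨ j = i - 1 ∨ j = i + l ∨ j = i - l := by
  have h1 : (1 : ZMod n) ≠ 0 := by
    simpa using natCast_zmod_ne_zero (n := n) (m := 1) one_pos (by omega)
  have h2 : (l : ZMod n) ≠ 0 := natCast_zmod_ne_zero (by omega) (by omega)
  simp only [circG, SimpleGraph.fromRel_adj, Set.mem_insert_iff, Set.mem_singleton_iff,
    exists_eq_or_imp, exists_eq_left, Nat.cast_one]
  constructor
  · grind
  · grind

theorem isZeroForcingSet_circG [NeZero n] (hl : 1 < l) (hn : 2 * l < n) :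
    IsZeroForcingSet (circG n {1, l}) {x | x.val < 2 * l} := by
  suffices h : ∀ m : ℕ, Forced (circG n {1, l}) {x | x.val < 2 * l} (m : ZMod n) by
    intro v
    simpa using h v.val
  intro m
  induction m using Nat.strong_induction_on with
  | _ m ih =>
    by_cases hm : m < 2 * l
    · refine .init _ ?_
      rw [Set.mem_ofPred_eq, ZMod.val_natCast, Nat.mod_eq_of_lt (by omega)]
      exact hm
    · obtain ⟨t, rfl⟩ := Nat.exists_eq_add_of_le (not_lt.mp hm)
      refine .force ((l + t : ℕ) : ZMod n) _ (ih _ (by omega)) ?_ ?_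
      · rw [circG_adj_iff hl hn]
        right; right; left
        push_cast
        ring
      · intro x hx hne
        rw [circG_adj_iff hl hn] at hx
        rcases hx with rfl | rfl | rfl | rfl
        · simpa using ih (l + t + 1) (by omega)
        · have := ih (l + t - 1) (by omega)
          rwa [Nat.cast_sub (by omega), Nat.cast_one] at this
        · refine absurd ?_ hne
          push_cast
          ring
        · simpa using ih t (by omega)

theorem ncard_setOf_val_lt [NeZero n] {m : ℕ} (hm : m ≤ n) :
    {x : ZMod n | x.val < m}.ncard = m := by
  have h : {x : ZMod n | x.val < m} = (fun a : ℕ => (a : ZMod n)) '' ↑(Finset.range m) := by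
    ext x
    simp only [Set.mem_ofPred_eq, Set.mem_image, Finset.coe_range, Set.mem_Iio]
    constructor
    · exact fun hx => ⟨x.val, hx, by simp⟩
    · rintro ⟨a, ha, rfl⟩
      rwa [ZMod.val_natCast, Nat.mod_eq_of_lt (by omega)]
  rw [h, Set.InjOn.ncard_image, Set.ncard_coe_finset, Finset.card_range]
  intro a ha b hb hab
  rw [Finset.coe_range, Set.mem_Iio] at ha hb
  simpa [ZMod.val_natCast, Nat.mod_eq_of_lt (ha.trans_le hm), Nat.mod_eq_of_lt (hb.trans_le hm)]
    using congrArg ZMod.val hab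

variable {F : Type*} [Field F]

theorem adjMat_circG_mulVec [NeZero n] (hl : 1 < l) (hn : 2 * l < n) (v : ZMod n → F)
    (i : ZMod n) :
    (adjMat F (circG n {1, l})).mulVec v i = v (i + 1) + v (i - 1) + v (i + l) + v (i - l) := by
  have h2 : (2 : ZMod n) ≠ 0 := by
    simpa using natCast_zmod_ne_zero (n := n) (m := 2) two_pos (by omega)
  have hll : ((2 * l : ℕ) : ZMod n) ≠ 0 := natCast_zmod_ne_zero (by omega) (by omega)
  have hadd : ((l + 1 : ℕ) : ZMod n) ≠ 0 := natCast_zmod_ne_zero (by omega) (by omega)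
  have hsub : ((l - 1 : ℕ) : ZMod n) ≠ 0 := natCast_zmod_ne_zero (by omega) (by omega)
  rw [Nat.cast_sub hl.le] at hsub
  push_cast at hll hadd hsub
  have hset : Finset.univ.filter ((circG n {1, l}).Adj i) = {i + 1, i - 1, i + l, i - l} := by
    ext j
    simp [circG_adj_iff hl hn]
  simp only [Matrix.mulVec, dotProduct, adjMat, Matrix.of_apply, ite_mul, one_mul, zero_mul]
  rw [← Finset.sum_filter, hset, Finset.sum_insert, Finset.sum_insert, Finset.sum_insert,
    Finset.sum_singleton]
  · ring
  · rw [Finset.mem_singleton]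
    exact fun h => hll (by linear_combination h)
  · simp only [Finset.mem_insert, Finset.mem_singleton]
    rintro (h | h)
    · exact hadd (by linear_combination -h)
    · exact hsub (by linear_combination h)
  · simp only [Finset.mem_insert, Finset.mem_singleton]
    rintro (h | h | h)
    · exact h2 (by linear_combination h)
    · exact hsub (by linear_combination -h)
    · exact hadd (by linear_combination h)

/-- The cyclic shift on functions on `ZMod n`. -/
def cyclicShift (F : Type*) [Field F] (n : ℕ) : Module.End F (ZMod n → F) :=
  LinearMap.funLeft F F fun i => i - 1

theorem cyclicShift_pow_apply (m : ℕ) (v : ZMod n → F) (i : ZMod n) :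
    (cyclicShift F n ^ m) v i = v (i - m) := by
  induction m generalizing i with
  | zero => simp
  | succ m ih =>
    rw [pow_succ', Module.End.mul_apply, cyclicShift, LinearMap.funLeft_apply, ← cyclicShift, ih]
    congr 1
    push_cast
    ring

open Polynomial

theorem aeval_cyclicShift_X_pow_sub_one : aeval (cyclicShift F n) (X ^ n - 1 : F[X]) = 0 := by
  ext v i
  simp [cyclicShift_pow_apply]

theorem exists_aeval_cyclicShift_single [NeZero n] (v : ZMod n → F) :
    ∃ p : F[X], aeval (cyclicShift F n) p (Pi.single 0 1) = v := by
  refine ⟨∑ j : ZMod n, C (v j) * X ^ j.val, ?_⟩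
  ext i
  simp [cyclicShift_pow_apply, Pi.single_apply, sub_eq_zero]

/-- If `f * g = X ^ n - 1`, then `f` evaluated at the cyclic shift has rank at most `deg g`. -/
theorem finrank_range_aeval_cyclicShift_le [NeZero n] {f g : F[X]} (hg : g.Monic)
    (hfg : f * g = X ^ n - 1) :
    Module.finrank F (LinearMap.range (aeval (cyclicShift F n) f)) ≤ g.natDegree := by
  set S := cyclicShift F n
  let φ : F[X] →ₗ[F] (ZMod n → F) :=
    (LinearMap.applyₗ (Pi.single 0 1)).comp (aeval S).toLinearMap
  have hrange : LinearMap.range (aeval S f) ≤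
      (degreeLT F g.natDegree).map ((aeval S f).comp φ) := by
    rintro _ ⟨v, rfl⟩
    obtain ⟨p, rfl⟩ := exists_aeval_cyclicShift_single v
    refine ⟨p %ₘ g, ?_, ?_⟩
    · rw [SetLike.mem_coe, mem_degreeLT, ← degree_eq_natDegree hg.ne_zero]
      exact degree_modByMonic_lt p hg
    · have hz : aeval S f * aeval S g = 0 := by
        rw [← map_mul, hfg, aeval_cyclicShift_X_pow_sub_one]
      have hp : aeval S f * aeval S p = aeval S f * aeval S (p %ₘ g) := by
        conv_lhs => rw [← modByMonic_add_div p g, map_add, map_mul, mul_add, ← mul_assoc, hz]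
        simp
      exact (LinearMap.congr_fun hp (Pi.single 0 1)).symm
  have : Module.Finite F (degreeLT F g.natDegree) :=
    Module.Finite.equiv (degreeLTEquiv F g.natDegree).symm
  calc _ ≤ _ := Submodule.finrank_mono hrange
    _ ≤ Module.finrank F (degreeLT F g.natDegree) := Submodule.finrank_map_le _ _
    _ = g.natDegree := by rw [(degreeLTEquiv F g.natDegree).finrank_eq, Module.finrank_fin_fun]

theorem rank_adjMat_circG_le [NeZero n] {m : ℕ} (hm : 0 < m) (hn : 2 * (2 * m + 1) < n)
    (hdvd : (X ^ (2 * m + 2) + 1) * (X ^ (2 * m) + 1) ∣ (X ^ n - 1 : F[X])) :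
    (adjMat F (circG n {1, 2 * m + 1})).rank ≤ n - 2 * (2 * m + 1) := by
  obtain ⟨g, hg⟩ := hdvd
  have h1 : (X ^ (2 * m + 2) + 1 : F[X]).Monic := monic_X_pow_add_C 1 (by omega)
  have h2 : (X ^ (2 * m) + 1 : F[X]).Monic := monic_X_pow_add_C 1 (by omega)
  have hmonic : g.Monic := (h1.mul h2).of_mul_monic_left
    (hg ▸ monic_X_pow_sub_C (1 : F) (NeZero.ne n))
  have hdeg : (X ^ n - 1 : F[X]).natDegree = n := natDegree_X_pow_sub_C (r := (1 : F))
  have hd1 : (X ^ (2 * m + 2) + 1 : F[X]).natDegree = 2 * m + 2 :=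
    natDegree_X_pow_add_C (r := (1 : F))
  have hd2 : (X ^ (2 * m) + 1 : F[X]).natDegree = 2 * m := natDegree_X_pow_add_C (r := (1 : F))
  rw [hg, (h1.mul h2).natDegree_mul hmonic, h1.natDegree_mul h2, hd1, hd2] at hdeg
  have hcomp : (adjMat F (circG n {1, 2 * m + 1})).mulVecLin =
      (LinearMap.funLeft F F fun i => i + ((2 * m + 1 : ℕ) : ZMod n)).comp
        (aeval (cyclicShift F n) ((X ^ (2 * m + 2) + 1) * (X ^ (2 * m) + 1) : F[X])) := by
    refine LinearMap.ext fun v => funext fun i => ?_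
    rw [Matrix.mulVecLin_apply, adjMat_circG_mulVec (by omega) hn,
      show ((X ^ (2 * m + 2) + 1) * (X ^ (2 * m) + 1) : F[X]) =
        X ^ (4 * m + 2) + X ^ (2 * m + 2) + X ^ (2 * m) + 1 by ring]
    simp only [LinearMap.comp_apply, LinearMap.funLeft_apply, map_add, map_pow, aeval_X, map_one,
      LinearMap.add_apply, Pi.add_apply, cyclicShift_pow_apply, Module.End.one_apply]
    push_cast
    ring_nf
  rw [Matrix.rank, hcomp, LinearMap.range_comp]
  calc _ ≤ _ := Submodule.finrank_map_le _ _
    _ ≤ g.natDegree := finrank_range_aeval_cyclicShift_le hmonic hg.symm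
    _ = _ := by omega

theorem X_pow_add_one_dvd_X_pow_sub_one {R : Type*} [CommRing R] {a N : ℕ} (h : 2 * a ∣ N) :
    (X ^ a + 1 : R[X]) ∣ X ^ N - 1 := by
  obtain ⟨c, rfl⟩ := h
  have h1 : (X ^ a + 1 : R[X]) ∣ X ^ (2 * a) - 1 := ⟨X ^ a - 1, by ring⟩
  refine h1.trans ?_
  rw [pow_mul _ (2 * a) c]
  exact sub_one_dvd_pow_sub_one _ _

theorem mul_dvd_X_pow_sub_one (R : Type*) [CommRing R] {m N : ℕ} (hm : 0 < m)
    (h1 : 2 * (2 * m + 2) ∣ N) (h2 : 2 * (2 * m) ∣ N) :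
    (X ^ (2 * m + 2) + 1) * (X ^ (2 * m) + 1) ∣ (X ^ N - 1 : R[X]) := by
  have hcop : IsCoprime (X ^ (2 * m + 2) + 1 : ℚ[X]) (X ^ (2 * m) + 1) := by
    obtain ⟨g, hg⟩ : (X ^ 2 - 1 : ℚ[X]) ∣ X ^ (2 * m) - 1 := by
      rw [pow_mul]
      exact sub_one_dvd_pow_sub_one _ _
    have hhalf : C (1 / 2 : ℚ) * 2 = 1 := by
      rw [← C_ofNat, ← C_mul]
      norm_num
    refine ⟨C (1 / 2) * g, C (1 / 2) * (1 - X ^ 2 * g), ?_⟩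
    linear_combination hhalf + C (1 / 2 : ℚ) * hg
  have hQ : (X ^ (2 * m + 2) + 1) * (X ^ (2 * m) + 1) ∣ (X ^ N - 1 : ℚ[X]) :=
    hcop.mul_dvd (X_pow_add_one_dvd_X_pow_sub_one h1) (X_pow_add_one_dvd_X_pow_sub_one h2)
  have hmonic : ((X ^ (2 * m + 2) + 1) * (X ^ (2 * m) + 1) : ℤ[X]).Monic :=
    (monic_X_pow_add_C 1 (by omega)).mul (monic_X_pow_add_C 1 (by omega))
  have hZ : (X ^ (2 * m + 2) + 1) * (X ^ (2 * m) + 1) ∣ (X ^ N - 1 : ℤ[X]) := by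
    rw [← map_dvd_map (Int.castRingHom ℚ) Int.cast_injective hmonic]
    simpa using hQ
  simpa using map_dvd (mapRingHom (Int.castRingHom R)) hZ

end Circulant

theorem stmt18 (k l : ℕ) (hk : 1 ≤ k) (hodd : Odd l) (h3 : 3 ≤ l) (h21 : l ≤ 21) :
    haveI : NeZero ((l ^ 2 - 1) * k) :=
      ⟨Nat.mul_ne_zero (Nat.sub_ne_zero_of_lt (by nlinarith)) (by omega)⟩
    ∀ (F : Type) [Field F],
      maxNullity F (circG ((l ^ 2 - 1) * k) {1, l})
          = zfn (circG ((l ^ 2 - 1) * k) {1, l}) ∧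
      zfn (circG ((l ^ 2 - 1) * k) {1, l}) = 2 * l ∧
      (adjMat F (circG ((l ^ 2 - 1) * k) {1, l})).rank = (l ^ 2 - 1) * k - 2 * l ∧
      minRank F (circG ((l ^ 2 - 1) * k) {1, l})
          = (adjMat F (circG ((l ^ 2 - 1) * k) {1, l})).rank := by
  intro F _
  obtain ⟨m, rfl⟩ := hodd
  have hfac : (2 * m + 1) ^ 2 - 1 = 2 * m * (2 * m + 2) := by
    rw [Nat.sub_eq_iff_eq_add (Nat.one_le_pow _ _ (by omega))]
    ring
  have hn : 2 * (2 * m + 1) < ((2 * m + 1) ^ 2 - 1) * k := by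
    rw [hfac]
    nlinarith [Nat.mul_le_mul_left (2 * m * (2 * m + 2)) hk]
  have : NeZero (((2 * m + 1) ^ 2 - 1) * k) := ⟨by omega⟩
  have hcard := ncard_setOf_val_lt hn.le
  have hrank := rank_adjMat_circG_le (F := F) (by omega) hn
    (mul_dvd_X_pow_sub_one F (by omega) ⟨m * k, by rw [hfac]; ring⟩ ⟨(m + 1) * k, by rw [hfac]; ring⟩)
  obtain ⟨hM, hz, hr, hmr⟩ := parameters_eq_of_adjMat_rank_le (F := F)
    (isZeroForcingSet_circG (by omega) hn) (by rw [hcard, ZMod.card]; exact hn.le)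
    (by rwa [hcard, ZMod.card])
  rw [hcard] at hM hz hr
  rw [ZMod.card] at hr
  exact ⟨hM.trans hz.symm, hz, hr, hmr⟩

end Paper
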